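/- Fix a real η > 0 and an integer α ≥ 1. Then lim_{R→∞} ∫_0^∞ [∫_{−∞}^{−R²} P_η(ξ) · (e^{3iπ/4}·τ_η(ξ)/(2(−σ)^{3/2})) · w(e^{3iπ/4}·τ_η(ξ)/(2√(−σ))) dσ] dξ = 0, where the inner integral is over σ ∈ (−∞, −R²] and both improper integrals exist for every R > 0. -/

import Mathlib

open scoped Real Topology
open Filter

/-- The error function `erf z = (2/√π) ∫_0^z e^{-t²} dt`, along the straight
segment from `0` to `z`. -/
noncomputable def cerf (z : ℂ) : ℂ :=
  2 / Real.sqrt Real.pi * (z * ∫ t in (0:ℝ)..1, Complex.exp (-(t * z) ^ 2))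

/-- `w(z) = e^{-z²} erfc(-iz)`. -/
noncomputable def wfun (z : ℂ) : ℂ :=
  Complex.exp (-z ^ 2) * (1 - cerf (-Complex.I * z))

/-- `P_η(ξ)`. -/
noncomputable def Pfun (a : ℕ) (η ξ : ℝ) : ℂ :=
  (Real.sqrt (Real.pi * η) : ℂ)⁻¹ * Complex.exp (Complex.I * (ξ ^ 2 / (4 * η) - Real.pi / 4))
  + ((a : ℂ) - 1) / (Real.sqrt Real.pi : ℂ) *
      Complex.exp (Complex.I * (Real.pi / 4 - ξ ^ 2 / 4))

/-- `τ_η(ξ)`. -/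
noncomputable def taufun (a : ℕ) (η ξ : ℝ) : ℂ :=
  2 * Real.sqrt η / Real.sqrt Real.pi * Complex.exp (Complex.I * (Real.pi / 4 + ξ ^ 2 / (4 * η)))
  + ξ * cerf (Complex.exp (-(Complex.I * (Real.pi / 4))) * ξ / (2 * Real.sqrt η))
  + 2 * ((a : ℂ) - 1) / Real.sqrt Real.pi *
      Complex.exp (-(Complex.I * (Real.pi / 4 + ξ ^ 2 / 4)))
  + ξ * ((a : ℂ) - 1) * cerf (Complex.exp (Complex.I * (Real.pi / 4)) * ξ / 2)

/-- An entire function has a global primitive. -/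
theorem exists_entire_primitive {f : ℂ → ℂ} (hf : Differentiable ℂ f) :
    ∃ E : ℂ → ℂ, ∀ z, HasDerivAt E (f z) z := by
  obtain ⟨E, hE⟩ := hf.isExactOn_univ
  exact ⟨E, fun z => hE z (Set.mem_univ z)⟩

theorem exists_primitive_cerf :
    ∃ E : ℂ → ℂ, (∀ z, HasDerivAt E (Complex.exp (-z ^ 2)) z) ∧
      ∀ z, cerf z = 2 / Real.sqrt Real.pi * (E z - E 0) := by
  obtain ⟨E, hE⟩ := exists_entire_primitive (f := fun z => Complex.exp (-z ^ 2)) (by fun_prop)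
  refine ⟨E, hE, fun z => ?_⟩
  have h : ∀ t : ℝ, HasDerivAt (fun t : ℝ => E (t * z)) (Complex.exp (-(t * z) ^ 2) * z) t := by
    intro t
    have h1 : HasDerivAt (fun t : ℝ => (t : ℂ) * z) z t := by
      simpa using (Complex.ofRealCLM.hasDerivAt (x := t)).mul_const z
    exact (hE (t * z)).comp t h1
  have h2 := intervalIntegral.integral_eq_sub_of_hasDerivAt (a := 0) (b := 1)
    (fun t _ => h t) ((by fun_prop : Continuous fun t : ℝ =>
      Complex.exp (-(t * z) ^ 2) * z).intervalIntegrable _ _)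
  rw [intervalIntegral.integral_mul_const] at h2
  rw [cerf, mul_comm z, h2]
  simp

theorem hasDerivAt_cerf (z : ℂ) :
    HasDerivAt cerf (2 / Real.sqrt Real.pi * Complex.exp (-z ^ 2)) z := by
  obtain ⟨E, hE, h⟩ := exists_primitive_cerf
  rw [funext h]
  exact ((hE z).sub_const _).const_mul _

theorem differentiable_cerf : Differentiable ℂ cerf :=
  fun z => (hasDerivAt_cerf z).differentiableAt

theorem differentiable_wfun : Differentiable ℂ wfun := by
  have := differentiable_cerf
  unfold wfun
  fun_prop

theorem two_div_sqrt_pi_le : 2 / Real.sqrt Real.pi ≤ 2 := by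
  have : 1 ≤ Real.sqrt Real.pi := Real.one_le_sqrt.2 (by linarith [Real.pi_gt_three])
  rw [div_le_iff₀ (by positivity)]
  linarith

/-- Truncations of `(2/√π) ∫_0^∞ e^{-t²+2izt} dt`, written with a primitive of the Gaussian,
are bounded on the closed upper half-plane. -/
theorem norm_gaussian_segment_le {E : ℂ → ℂ}
    (hE : ∀ z, HasDerivAt E (Complex.exp (-z ^ 2)) z) {z : ℂ} (hz : 0 ≤ z.im) {T : ℝ}
    (hT : 0 ≤ T) :
    ‖Complex.exp (-z ^ 2) * (2 / Real.sqrt Real.pi *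
      (E (T - Complex.I * z) - E (-Complex.I * z)))‖ ≤ 3 / (1 + z.im) := by
  have hd : ∀ t : ℝ, HasDerivAt (fun t : ℝ => Complex.exp (-z ^ 2) * (2 / Real.sqrt Real.pi *
      (E (t - Complex.I * z) - E (-Complex.I * z))))
      (Complex.exp (-z ^ 2) * (2 / Real.sqrt Real.pi *
        Complex.exp (-(t - Complex.I * z) ^ 2))) t := by
    intro t
    have h1 : HasDerivAt (fun t : ℝ => (t : ℂ) - Complex.I * z) 1 t := by
      simpa using (Complex.ofRealCLM.hasDerivAt (x := t)).sub_const (Complex.I * z)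
    have h2 := (hE (t - Complex.I * z)).comp t h1
    rw [mul_one] at h2
    exact ((h2.sub_const _).const_mul _).const_mul _
  set y := z.im with hy
  have hy1 : 0 < 1 + y := by linarith
  have hB : ∀ t : ℝ, HasDerivAt (fun t : ℝ => Real.exp 1 / (1 + y) *
      (1 - Real.exp (-(2 * (1 + y) * t)))) (2 * Real.exp 1 * Real.exp (-(2 * (1 + y) * t))) t := by
    intro t
    have h1 : HasDerivAt (fun t : ℝ => -(2 * (1 + y) * t)) (-(2 * (1 + y))) t := by
      simpa using ((hasDerivAt_id t).const_mul (2 * (1 + y))).fun_neg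
    refine ((h1.exp.const_sub 1).const_mul (Real.exp 1 / (1 + y))).congr_deriv ?_
    have hne : 1 + y ≠ 0 := hy1.ne'
    field_simp
  have hbd : ∀ t : ℝ, ‖Complex.exp (-z ^ 2) * (2 / Real.sqrt Real.pi *
        Complex.exp (-(t - Complex.I * z) ^ 2))‖ ≤
      2 * Real.exp 1 * Real.exp (-(2 * (1 + y) * t)) := by
    intro t
    have e1 : Complex.exp (-z ^ 2) * (2 / Real.sqrt Real.pi *
        Complex.exp (-(t - Complex.I * z) ^ 2)) =
        ((2 / Real.sqrt Real.pi : ℝ) : ℂ) * Complex.exp (-t ^ 2 + 2 * Complex.I * z * t) := by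
      rw [mul_left_comm, ← Complex.exp_add]
      push_cast
      congr 2
      linear_combination (- z ^ 2) * Complex.I_sq
    have e2 : (-(t : ℂ) ^ 2 + 2 * Complex.I * z * t).re = -t ^ 2 - 2 * y * t := by
      simp [pow_two, hy]
      ring
    rw [e1, norm_mul, Complex.norm_exp, e2, Complex.norm_real, Real.norm_of_nonneg (by positivity),
      mul_assoc 2 (Real.exp 1), ← Real.exp_add]
    refine mul_le_mul two_div_sqrt_pi_le (Real.exp_le_exp.2 ?_) (by positivity) (by norm_num)
    nlinarith [sq_nonneg (t - 1)]
  have key := image_norm_le_of_norm_deriv_right_le_deriv_boundary (a := 0) (b := T)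
    (fun t _ => (hd t).continuousAt.continuousWithinAt)
    (fun t _ => (hd t).hasDerivWithinAt) (B := fun t : ℝ => Real.exp 1 / (1 + y) *
      (1 - Real.exp (-(2 * (1 + y) * t)))) (by simp) hB (fun t _ => hbd t)
    (Set.right_mem_Icc.2 hT)
  refine key.trans ?_
  rw [div_mul_eq_mul_div]
  gcongr
  have h3 := Real.exp_pos (-(2 * (1 + y) * T))
  have h4 := Real.exp_one_lt_d9
  have h5 := Real.exp_pos 1
  nlinarith

theorem tendsto_gaussian_segment {E : ℂ → ℂ}
    (hE : ∀ z, HasDerivAt E (Complex.exp (-z ^ 2)) z) {z : ℂ} (hz : 0 ≤ z.im) :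
    Tendsto (fun T : ℝ => E (T - Complex.I * z)) atTop (𝓝 (E 0 + Real.sqrt Real.pi / 2)) := by
  have h1 : Tendsto (fun T : ℝ => E T - E 0) atTop (𝓝 (Real.sqrt Real.pi / 2)) := by
    have hd : ∀ t : ℝ, HasDerivAt (fun t : ℝ => E t) ((Real.exp (-1 * t ^ 2) : ℝ) : ℂ) t := by
      intro t
      simpa using (hE t).comp_ofReal
    have e : ∀ T : ℝ, E T - E 0 = ((∫ t in (0:ℝ)..T, Real.exp (-1 * t ^ 2) : ℝ) : ℂ) := by
      intro T
      rw [← intervalIntegral.integral_ofReal, intervalIntegral.integral_eq_sub_of_hasDerivAt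
        (fun t _ => hd t) ((by fun_prop : Continuous fun t : ℝ =>
          ((Real.exp (-1 * t ^ 2) : ℝ) : ℂ)).intervalIntegrable _ _)]
      simp
    have h := MeasureTheory.intervalIntegral_tendsto_integral_Ioi 0
      (integrable_exp_neg_mul_sq (zero_lt_one)).integrableOn tendsto_id
    rw [integral_gaussian_Ioi] at h
    simp_rw [e]
    have h' := (Complex.continuous_ofReal.tendsto _).comp h
    simpa [Function.comp_def] using h'
  have h2 : Tendsto (fun T : ℝ => E (T - Complex.I * z) - E T) atTop (𝓝 0) := by
    have hb : ∀ T : ℝ, 0 ≤ T → ‖E (T - Complex.I * z) - E T‖ ≤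
        Real.exp (z.re ^ 2 + 1) * ‖z‖ * Real.exp (-(2 * T)) := by
      intro T hT
      have hd : ∀ s : ℝ, HasDerivAt (fun s : ℝ => E (T - s * (Complex.I * z)))
          (Complex.exp (-(T - s * (Complex.I * z)) ^ 2) * (-(Complex.I * z))) s := by
        intro s
        have h1 : HasDerivAt (fun s : ℝ => (T : ℂ) - s * (Complex.I * z)) (-(Complex.I * z)) s := by
          simpa using ((Complex.ofRealCLM.hasDerivAt (x := s)).mul_const
            (Complex.I * z)).const_sub (T : ℂ)
        exact (hE _).comp s h1
      have := norm_image_sub_le_of_norm_deriv_le_segment_01'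
        (C := Real.exp (z.re ^ 2 + 1) * ‖z‖ * Real.exp (-(2 * T)))
        (fun s _ => (hd s).hasDerivWithinAt) (by
          rintro s ⟨hs0, hs1⟩
          have e : (-((T : ℂ) - s * (Complex.I * z)) ^ 2).re =
              s ^ 2 * z.re ^ 2 - (T + s * z.im) ^ 2 := by
            simp [pow_two]
            ring
          rw [norm_mul, Complex.norm_exp, e, norm_neg, norm_mul, Complex.norm_I, one_mul,
            mul_right_comm, ← Real.exp_add]
          gcongr
          have h3 : s ^ 2 ≤ 1 := by nlinarith
          have h4 : 0 ≤ s * z.im := mul_nonneg hs0 hz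
          nlinarith [sq_nonneg (T - 1), sq_nonneg z.re, mul_nonneg hT h4])
      simpa using this
    refine squeeze_zero_norm' ((eventually_ge_atTop 0).mono hb) ?_
    have h3 : Tendsto (fun T : ℝ => Real.exp (-(2 * T))) atTop (𝓝 0) :=
      Real.tendsto_exp_neg_atTop_nhds_zero.comp (tendsto_id.const_mul_atTop (by norm_num))
    simpa using h3.const_mul (Real.exp (z.re ^ 2 + 1) * ‖z‖)
  have h3 := (h2.add h1).add_const (E 0)
  rw [zero_add, add_comm] at h3
  refine h3.congr fun T => ?_
  ring

/-- Decay of the Faddeeva function in the closed upper half-plane. -/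
theorem norm_wfun_le {z : ℂ} (hz : 0 ≤ z.im) : ‖wfun z‖ ≤ 3 / (1 + z.im) := by
  obtain ⟨E, hE, hc⟩ := exists_primitive_cerf
  have h := (((tendsto_gaussian_segment hE hz).sub_const (E (-Complex.I * z))).const_mul
    (2 / Real.sqrt Real.pi : ℂ)).const_mul (Complex.exp (-z ^ 2))
  have e : Complex.exp (-z ^ 2) * (2 / Real.sqrt Real.pi *
      (E 0 + Real.sqrt Real.pi / 2 - E (-Complex.I * z))) = wfun z := by
    have : (Real.sqrt Real.pi : ℂ) ≠ 0 :=
      Complex.ofReal_ne_zero.2 (Real.sqrt_ne_zero'.2 Real.pi_pos)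
    rw [wfun, hc]
    field_simp
    ring
  rw [e] at h
  exact le_of_tendsto h.norm
    ((eventually_ge_atTop 0).mono fun T hT => norm_gaussian_segment_le hE hz hT)

theorem norm_one_sub_cerf_le {y : ℂ} (hy : 0 ≤ y.re) (hy2 : (y ^ 2).re = 0) :
    ‖1 - cerf y‖ ≤ 3 / (1 + y.re) := by
  have h := norm_wfun_le (z := Complex.I * y) (by simpa using hy)
  have e : -Complex.I * (Complex.I * y) = y := by
    linear_combination (-y) * Complex.I_sq
  have e2 : -(Complex.I * y) ^ 2 = y ^ 2 := by
    linear_combination (-y ^ 2) * Complex.I_sq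
  rw [wfun, e, e2, norm_mul, Complex.norm_exp, hy2, Real.exp_zero, one_mul] at h
  simpa using h

theorem hasDerivAt_div_sqrt_neg (v : ℂ) {σ : ℝ} (hσ : σ < 0) :
    HasDerivAt (fun σ : ℝ => v / (2 * Real.sqrt (-σ)))
      (v / ((4 * Real.sqrt (-σ) ^ 3 : ℝ) : ℂ)) σ := by
  have hs : 0 < Real.sqrt (-σ) := Real.sqrt_pos.2 (by linarith)
  have hsc : (Real.sqrt (-σ) : ℂ) ≠ 0 := Complex.ofReal_ne_zero.2 hs.ne'
  have h1 := ((hasDerivAt_neg σ).sqrt (by linarith : -σ ≠ 0)).ofReal_comp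
  have h2 := (hasDerivAt_const σ v).div (h1.const_mul (2 : ℂ)) (by simpa using hs.ne')
  refine h2.congr_deriv ?_
  push_cast
  field_simp
  ring

theorem integrableOn_inv_sqrt_neg_pow_three {R : ℝ} (hR : 0 < R) :
    MeasureTheory.IntegrableOn (fun σ : ℝ => (Real.sqrt (-σ) ^ 3)⁻¹) (Set.Iic (-(R ^ 2))) := by
  have hR2 : 0 < R ^ 2 := by positivity
  have h1 : MeasureTheory.IntegrableOn (fun t : ℝ => t ^ (-(3 / 2) : ℝ))
      (Set.Ici (-(-(R ^ 2)))) := by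
    rw [neg_neg, integrableOn_Ici_iff_integrableOn_Ioi]
    exact integrableOn_Ioi_rpow_of_lt (by norm_num) hR2
  have h := h1.comp_neg_Iic
  refine h.congr_fun (fun σ hσ => ?_) measurableSet_Iic
  have hσ' : σ ≤ -(R ^ 2) := hσ
  have h0 : 0 ≤ -σ := by nlinarith [sq_nonneg R]
  simp only
  rw [Real.rpow_neg h0, Real.sqrt_eq_rpow, ← Real.rpow_natCast, ← Real.rpow_mul h0]
  norm_num

theorem integral_tail_wfun {W : ℂ → ℂ} (hW : ∀ z, HasDerivAt W (wfun z) z) (v : ℂ) {R : ℝ}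
    (hR : 0 < R) :
    MeasureTheory.IntegrableOn (fun σ : ℝ => v / ((2 * Real.sqrt (-σ) ^ 3 : ℝ) : ℂ) *
        wfun (v / (2 * Real.sqrt (-σ)))) (Set.Iic (-(R ^ 2))) ∧
      ∫ σ in Set.Iic (-(R ^ 2)), v / ((2 * Real.sqrt (-σ) ^ 3 : ℝ) : ℂ) *
        wfun (v / (2 * Real.sqrt (-σ))) = 2 * (W (v / (2 * R)) - W 0) := by
  have hneg : ∀ σ ∈ Set.Iic (-(R ^ 2)), σ < 0 := fun σ hσ => by
    have : σ ≤ -(R ^ 2) := hσ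
    nlinarith [sq_pos_of_pos hR]
  have hsqrt : ∀ σ ∈ Set.Iic (-(R ^ 2)), R ≤ Real.sqrt (-σ) := fun σ hσ => by
    have : σ ≤ -(R ^ 2) := hσ
    exact Real.le_sqrt_of_sq_le (by linarith)
  have hint : MeasureTheory.IntegrableOn (fun σ : ℝ => v / ((2 * Real.sqrt (-σ) ^ 3 : ℝ) : ℂ) *
        wfun (v / (2 * Real.sqrt (-σ)))) (Set.Iic (-(R ^ 2))) := by
    obtain ⟨M, hM⟩ := (isCompact_closedBall (0 : ℂ) (‖v‖ / (2 * R))).exists_bound_of_continuousOn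
      differentiable_wfun.continuous.continuousOn
    refine MeasureTheory.Integrable.mono'
      ((integrableOn_inv_sqrt_neg_pow_three hR).const_mul (‖v‖ / 2 * M)) ?_ ?_
    · refine ContinuousOn.aestronglyMeasurable (fun σ hσ => ?_) measurableSet_Iic
      have h1 := hasDerivAt_div_sqrt_neg v (hneg σ hσ)
      have h2 := differentiable_wfun.continuous.continuousAt.comp h1.continuousAt
      have h3 : Real.sqrt (-σ) ≠ 0 := (hR.trans_le (hsqrt σ hσ)).ne'
      refine ContinuousAt.continuousWithinAt (ContinuousAt.mul ?_ h2)
      refine ContinuousAt.div continuousAt_const (by fun_prop) ?_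
      exact Complex.ofReal_ne_zero.2 (by positivity)
    · refine (MeasureTheory.ae_restrict_mem measurableSet_Iic).mono fun σ hσ => ?_
      have hs := hsqrt σ hσ
      have hs0 : 0 < Real.sqrt (-σ) := hR.trans_le hs
      rw [norm_mul, norm_div, Complex.norm_real, Real.norm_of_nonneg (by positivity)]
      have h4 : ‖wfun (v / (2 * Real.sqrt (-σ)))‖ ≤ M := by
        apply hM
        rw [mem_closedBall_zero_iff, norm_div, norm_mul, Complex.norm_real,
          Real.norm_of_nonneg hs0.le, Complex.norm_ofNat]
        gcongr
      calc ‖v‖ / (2 * Real.sqrt (-σ) ^ 3) * ‖wfun (v / (2 * Real.sqrt (-σ)))‖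
          ≤ ‖v‖ / (2 * Real.sqrt (-σ) ^ 3) * M := by gcongr
        _ = ‖v‖ / 2 * M * (Real.sqrt (-σ) ^ 3)⁻¹ := by field_simp
  refine ⟨hint, ?_⟩
  have hd : ∀ σ ∈ Set.Iic (-(R ^ 2)), HasDerivAt (fun σ : ℝ => 2 * W (v / (2 * Real.sqrt (-σ))))
      (v / ((2 * Real.sqrt (-σ) ^ 3 : ℝ) : ℂ) * wfun (v / (2 * Real.sqrt (-σ)))) σ := by
    intro σ hσ
    have h1 := ((hW _).comp σ (hasDerivAt_div_sqrt_neg v (hneg σ hσ))).const_mul 2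
    have hs : (Real.sqrt (-σ) : ℂ) ≠ 0 :=
      Complex.ofReal_ne_zero.2 (hR.trans_le (hsqrt σ hσ)).ne'
    refine h1.congr_deriv ?_
    push_cast
    field_simp
    ring
  have hlim : Tendsto (fun σ : ℝ => 2 * W (v / (2 * Real.sqrt (-σ)))) atBot (𝓝 (2 * W 0)) := by
    refine ((hW 0).continuousAt.tendsto.comp ?_).const_mul 2
    rw [tendsto_zero_iff_norm_tendsto_zero]
    have h2 : Tendsto (fun σ : ℝ => 2 * Real.sqrt (-σ)) atBot atTop :=
      (Real.tendsto_sqrt_atTop.comp tendsto_neg_atBot_atTop).const_mul_atTop (by norm_num)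
    refine (h2.const_div_atTop ‖v‖).congr fun σ => ?_
    rw [norm_div, norm_mul, Complex.norm_real, Real.norm_of_nonneg (Real.sqrt_nonneg _),
      Complex.norm_ofNat]
  rw [MeasureTheory.integral_Iic_of_hasDerivAt_of_tendsto' hd hint hlim, neg_neg,
    Real.sqrt_sq hR.le]
  ring

section OscillatoryTail

variable {τ τ' P : ℝ → ℂ} {c : ℂ} {α B C : ℝ} {W : ℂ → ℂ}

/-- The `ξ`-derivative of `W (c τ(ξ) / (2R))` for a primitive `W` of `wfun` is `O(1/(R+ξ))`,
uniformly in `R` away from `0`. -/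
theorem exists_norm_wfun_mul_le (hα : 1 ≤ α) (hB : ∀ ξ : ℝ, 0 ≤ ξ → ‖τ ξ - α * ξ‖ ≤ B)
    (hC : ∀ ξ : ℝ, 0 ≤ ξ → ‖τ' ξ - α‖ ≤ C / (1 + ξ)) (hc : ‖c‖ = 1) (hc' : 7 / 10 ≤ c.im)
    {R₀ : ℝ} (hR₀ : 0 < R₀) :
    ∃ K : ℝ, 0 ≤ K ∧ ∀ R : ℝ, R₀ ≤ R → ∀ ξ : ℝ, 0 ≤ ξ →
      ‖wfun (c * τ ξ / (2 * R)) * (c * τ' ξ / (2 * R))‖ ≤ K / (R + ξ) := by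
  have hB0 : 0 ≤ B := (norm_nonneg _).trans (hB 0 le_rfl)
  have hC0 : 0 ≤ C := by simpa using (norm_nonneg _).trans (hC 0 le_rfl)
  have hA : ∀ ξ : ℝ, 0 ≤ ξ → ‖τ' ξ‖ ≤ α + C := by
    intro ξ hξ
    have h1 : C / (1 + ξ) ≤ C := div_le_self hC0 (by linarith)
    have h2 : ‖(α : ℂ)‖ = α := by rw [Complex.norm_real, Real.norm_of_nonneg (by linarith)]
    have h3 := norm_add_le (τ' ξ - α) α
    rw [sub_add_cancel] at h3
    linarith [hC ξ hξ]
  obtain ⟨M, hM⟩ := (isCompact_closedBall (0 : ℂ)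
    ((α * (5 * B) + B) / (2 * R₀))).exists_bound_of_continuousOn
      differentiable_wfun.continuous.continuousOn
  have hM0 : 0 ≤ M := (norm_nonneg _).trans (hM 0 (by
    rw [mem_closedBall_zero_iff, norm_zero]; positivity))
  have hA0 : 0 ≤ α + C := by linarith
  refine ⟨M * (α + C) * (1 + 5 * B / R₀) + 6 * (α + C), by positivity, fun R hR ξ hξ => ?_⟩
  have hR0 : 0 < R := hR₀.trans_le hR
  have hsum : 0 < R + ξ := by linarith
  have hden : ‖(2 * R : ℂ)‖ = 2 * R := by
    rw [norm_mul, Complex.norm_real, Real.norm_of_nonneg hR0.le, Complex.norm_ofNat]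
  have hv : ‖c * τ' ξ / (2 * R)‖ ≤ (α + C) / (2 * R) := by
    rw [norm_div, norm_mul, hc, one_mul, hden]
    gcongr
    exact hA ξ hξ
  rw [norm_mul, le_div_iff₀ hsum]
  rcases le_total ξ (5 * B) with h | h
  · have hw : ‖wfun (c * τ ξ / (2 * R))‖ ≤ M := by
      apply hM
      rw [mem_closedBall_zero_iff, norm_div, norm_mul, hc, one_mul, hden]
      have h1 : ‖τ ξ‖ ≤ α * (5 * B) + B := by
        have h3 := norm_add_le (τ ξ - α * ξ) (α * ξ)
        rw [sub_add_cancel, norm_mul, Complex.norm_real, Complex.norm_real,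
          Real.norm_of_nonneg hξ, Real.norm_of_nonneg (by linarith : (0:ℝ) ≤ α)] at h3
        have h4 : α * ξ ≤ α * (5 * B) := by gcongr
        linarith [hB ξ hξ]
      gcongr
    have h5 : R + ξ ≤ R * (1 + 5 * B / R₀) := by
      have h6 : 5 * B ≤ R * (5 * B / R₀) := by
        rw [mul_div_assoc', le_div_iff₀ hR₀, mul_comm R]
        gcongr
      linarith
    calc ‖wfun (c * τ ξ / (2 * R))‖ * ‖c * τ' ξ / (2 * R)‖ * (R + ξ)
        ≤ M * ((α + C) / (2 * R)) * (R * (1 + 5 * B / R₀)) := by gcongr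
      _ = M * (α + C) * (1 + 5 * B / R₀) / 2 := by field_simp
      _ ≤ M * (α + C) * (1 + 5 * B / R₀) + 6 * (α + C) := by
        have : 0 ≤ M * (α + C) * (1 + 5 * B / R₀) := by positivity
        linarith
  · have him : ξ / 2 ≤ (c * τ ξ).im := by
      have h1 : c * τ ξ = c * (α * ξ : ℝ) + c * (τ ξ - α * ξ) := by push_cast; ring
      have h2 : |(c * (τ ξ - α * ξ)).im| ≤ B := by
        refine (Complex.abs_im_le_norm _).trans ?_
        rw [norm_mul, hc, one_mul]
        exact hB ξ hξ
      have h3 : (c * ((α * ξ : ℝ) : ℂ)).im = c.im * (α * ξ) := by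
        rw [Complex.im_mul_ofReal]
      rw [h1, Complex.add_im, h3]
      have h4 : ξ ≤ α * ξ := by nlinarith
      have h5 : 7 / 10 * ξ ≤ c.im * (α * ξ) := mul_le_mul hc' h4 hξ (by linarith)
      linarith [neg_abs_le (c * (τ ξ - α * ξ)).im]
    have him2 : ξ / (4 * R) ≤ (c * τ ξ / (2 * R)).im := by
      have h1 : (c * τ ξ / (2 * R)).im = (c * τ ξ).im / (2 * R) := by
        rw [← Complex.div_ofReal_im]
        push_cast
        rfl
      rw [h1]
      calc ξ / (4 * R) = ξ / 2 / (2 * R) := by field_simp; norm_num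
        _ ≤ _ := by gcongr
    have hpos : 0 ≤ ξ / (4 * R) := by positivity
    have hw : ‖wfun (c * τ ξ / (2 * R))‖ ≤ 3 / (1 + ξ / (4 * R)) :=
      (norm_wfun_le (hpos.trans him2)).trans (by gcongr)
    calc ‖wfun (c * τ ξ / (2 * R))‖ * ‖c * τ' ξ / (2 * R)‖ * (R + ξ)
        ≤ 3 / (1 + ξ / (4 * R)) * ((α + C) / (2 * R)) * (4 * R + ξ) := by
          gcongr; linarith
      _ = 6 * (α + C) := by field_simp; norm_num
      _ ≤ M * (α + C) * (1 + 5 * B / R₀) + 6 * (α + C) := by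
        have : 0 ≤ M * (α + C) * (1 + 5 * B / R₀) := by positivity
        linarith

theorem exists_norm_wfun_mul_le' (hα : 1 ≤ α) (hB : ∀ ξ : ℝ, 0 ≤ ξ → ‖τ ξ - α * ξ‖ ≤ B)
    (hC : ∀ ξ : ℝ, 0 ≤ ξ → ‖τ' ξ - α‖ ≤ C / (1 + ξ)) (hc : ‖c‖ = 1) (hc' : 7 / 10 ≤ c.im)
    {R₀ : ℝ} (hR₀ : 0 < R₀) :
    ∃ K : ℝ, 0 ≤ K ∧ ∀ R : ℝ, R₀ ≤ R → ∀ ξ : ℝ, 0 ≤ ξ →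
      ‖wfun (c * τ ξ / (2 * R)) * (c * τ' ξ / (2 * R))‖ ≤ K / R ∧
      ‖wfun (c * τ ξ / (2 * R)) * (c * τ' ξ / (2 * R))‖ ≤ K / (1 + ξ) := by
  obtain ⟨K, hK, h⟩ := exists_norm_wfun_mul_le hα hB hC hc hc' hR₀
  refine ⟨K * (1 + 1 / R₀), by positivity, fun R hR ξ hξ => ?_⟩
  have hR0 : 0 < R := hR₀.trans_le hR
  have hinv : 0 < 1 / R₀ := by positivity
  constructor
  · refine (h R hR ξ hξ).trans ?_
    gcongr
    · nlinarith
    · linarith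
  · refine (h R hR ξ hξ).trans ?_
    rw [div_le_div_iff₀ (by linarith) (by linarith), mul_assoc]
    gcongr
    have h1 : 1 ≤ 1 / R₀ * R := by
      rw [one_div, inv_mul_eq_div, one_le_div hR₀]
      exact hR
    nlinarith [mul_nonneg hinv.le hξ]

theorem hasDerivAt_primitive_comp (hτ : ∀ ξ, HasDerivAt τ (τ' ξ) ξ)
    (hW : ∀ z, HasDerivAt W (wfun z) z) (c : ℂ) (R ξ : ℝ) :
    HasDerivAt (fun ξ => W (c * τ ξ / (2 * R)))
      (wfun (c * τ ξ / (2 * R)) * (c * τ' ξ / (2 * R))) ξ :=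
  (hW _).comp ξ (((hτ ξ).const_mul c).div_const _)

theorem tendsto_log_one_add_div :
    Tendsto (fun X : ℝ => Real.log (1 + X) / (1 + X)) atTop (𝓝 0) := by
  have h := (Real.tendsto_pow_log_div_mul_add_atTop 1 0 1 one_ne_zero).comp
    (tendsto_const_nhds.add_atTop tendsto_id : Tendsto (fun X : ℝ => 1 + X) atTop atTop)
  simpa [Function.comp_def] using h

theorem tendsto_boundary_term (hτ : ∀ ξ, HasDerivAt τ (τ' ξ) ξ) (hα : 1 ≤ α)
    (hB : ∀ ξ : ℝ, 0 ≤ ξ → ‖τ ξ - α * ξ‖ ≤ B)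
    (hC : ∀ ξ : ℝ, 0 ≤ ξ → ‖τ' ξ - α‖ ≤ C / (1 + ξ)) (hc : ‖c‖ = 1) (hc' : 7 / 10 ≤ c.im)
    (hW : ∀ z, HasDerivAt W (wfun z) z) {R : ℝ} (hR : 0 < R) :
    Tendsto (fun X : ℝ => W (c * τ X / (2 * R)) * (τ' X - α)) atTop (𝓝 0) := by
  obtain ⟨K, hK, h⟩ := exists_norm_wfun_mul_le' hα hB hC hc hc' hR
  have hC0 : 0 ≤ C := by simpa using (norm_nonneg _).trans (hC 0 le_rfl)
  have hd := hasDerivAt_primitive_comp hτ hW c R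
  set N := ‖W (c * τ 0 / (2 * R))‖ with hN
  have hlog : ∀ t : ℝ, 0 ≤ t →
      HasDerivAt (fun t : ℝ => N + K * Real.log (1 + t)) (K / (1 + t)) t := by
    intro t ht
    have h1 : HasDerivAt (fun t : ℝ => 1 + t) 1 t := (hasDerivAt_id t).const_add 1
    refine (((h1.log (by linarith)).const_mul K).const_add N).congr_deriv ?_
    ring
  have hbd : ∀ X : ℝ, 0 ≤ X → ‖W (c * τ X / (2 * R))‖ ≤ N + K * Real.log (1 + X) := by
    intro X hX
    exact image_norm_le_of_norm_deriv_right_le_deriv_boundary' (a := 0) (b := X)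
      (f := fun ξ => W (c * τ ξ / (2 * R))) (B := fun t : ℝ => N + K * Real.log (1 + t))
      (fun t _ => (hd t).continuousAt.continuousWithinAt)
      (fun t _ => (hd t).hasDerivWithinAt) (by simp [hN])
      (fun t ht => (hlog t ht.1).continuousAt.continuousWithinAt)
      (fun t ht => (hlog t ht.1).hasDerivWithinAt)
      (fun t ht => (h R le_rfl t ht.1).2) (Set.right_mem_Icc.2 hX)
  have hlim : Tendsto (fun X : ℝ => C * (N / (1 + X) + K * (Real.log (1 + X) / (1 + X))))
      atTop (𝓝 0) := by
    have h1 : Tendsto (fun X : ℝ => N / (1 + X)) atTop (𝓝 0) :=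
      (tendsto_const_nhds.add_atTop tendsto_id : Tendsto (fun X : ℝ => 1 + X) atTop
        atTop).const_div_atTop N
    simpa using (h1.add (tendsto_log_one_add_div.const_mul K)).const_mul C
  refine squeeze_zero_norm' ((eventually_ge_atTop 0).mono fun X hX => ?_) hlim
  rw [norm_mul]
  have hX1 : 0 < 1 + X := by linarith
  have hl : 0 ≤ Real.log (1 + X) := Real.log_nonneg (by linarith)
  calc ‖W (c * τ X / (2 * R))‖ * ‖τ' X - α‖
      ≤ (N + K * Real.log (1 + X)) * (C / (1 + X)) :=
        mul_le_mul (hbd X hX) (hC X hX) (norm_nonneg _) (by positivity)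
    _ = _ := by ring

/-- Integrating `P ξ * W (c * τ ξ / (2 * R))` by parts, where `P` is the second derivative of `τ`,
shows that the improper integral over `[0, ∞)` exists for every `R > 0` and tends to `0` as `R → ∞`. -/
theorem exists_tendsto_integral_primitive (hτ : ∀ ξ, HasDerivAt τ (τ' ξ) ξ)
    (hτ' : ∀ ξ, HasDerivAt τ' (P ξ) ξ) (hP : Continuous P) (hα : 1 ≤ α)
    (hB : ∀ ξ : ℝ, 0 ≤ ξ → ‖τ ξ - α * ξ‖ ≤ B)
    (hC : ∀ ξ : ℝ, 0 ≤ ξ → ‖τ' ξ - α‖ ≤ C / (1 + ξ)) (hc : ‖c‖ = 1) (hc' : 7 / 10 ≤ c.im)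
    (hW : ∀ z, HasDerivAt W (wfun z) z) (hW0 : W 0 = 0) :
    ∃ J : ℝ → ℂ,
      (∀ R : ℝ, 0 < R → Tendsto
        (fun X : ℝ => ∫ ξ in (0:ℝ)..X, W (c * τ ξ / (2 * R)) * P ξ) atTop (𝓝 (J R))) ∧
      Tendsto J atTop (𝓝 0) := by
  have hC0 : 0 ≤ C := by simpa using (norm_nonneg _).trans (hC 0 le_rfl)
  have hτc : Continuous τ := continuous_iff_continuousAt.2 fun ξ => (hτ ξ).continuousAt
  have hτc' : Continuous τ' := continuous_iff_continuousAt.2 fun ξ => (hτ' ξ).continuousAt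
  have hwc := differentiable_wfun.continuous
  have hDc : ∀ R : ℝ, Continuous fun ξ =>
      wfun (c * τ ξ / (2 * R)) * (c * τ' ξ / (2 * R)) := by fun_prop
  have hbound : ∀ K : ℝ, 0 ≤ K → ∀ ξ : ℝ, 0 ≤ ξ → ∀ D : ℂ, ‖D‖ ≤ K / (1 + ξ) →
      ‖D * (τ' ξ - α)‖ ≤ K * C * (1 + ξ ^ 2)⁻¹ := by
    intro K hK ξ hξ D hD
    rw [norm_mul]
    calc ‖D‖ * ‖τ' ξ - α‖ ≤ K / (1 + ξ) * (C / (1 + ξ)) :=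
          mul_le_mul hD (hC ξ hξ) (norm_nonneg _) (by positivity)
      _ = K * C * ((1 + ξ) ^ 2)⁻¹ := by field_simp
      _ ≤ K * C * (1 + ξ ^ 2)⁻¹ := by gcongr; nlinarith
  have hmaj : ∀ K : ℝ, MeasureTheory.IntegrableOn (fun ξ : ℝ => K * C * (1 + ξ ^ 2)⁻¹)
      (Set.Ioi 0) := fun K => (integrable_inv_one_add_sq.const_mul _).integrableOn
  refine ⟨fun R => -(W (c * τ 0 / (2 * R)) * (τ' 0 - α)) - ∫ ξ in Set.Ioi (0:ℝ),
    wfun (c * τ ξ / (2 * R)) * (c * τ' ξ / (2 * R)) * (τ' ξ - α), fun R hR => ?_, ?_⟩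
  · obtain ⟨K, hK, h⟩ := exists_norm_wfun_mul_le' hα hB hC hc hc' hR
    have hint : MeasureTheory.IntegrableOn (fun ξ : ℝ =>
        wfun (c * τ ξ / (2 * R)) * (c * τ' ξ / (2 * R)) * (τ' ξ - α)) (Set.Ioi 0) := by
      refine MeasureTheory.Integrable.mono' (hmaj K)
        ((hDc R).mul (hτc'.sub continuous_const)).aestronglyMeasurable ?_
      exact (MeasureTheory.ae_restrict_mem measurableSet_Ioi).mono fun ξ hξ =>
        hbound K hK ξ (le_of_lt hξ) _ (h R le_rfl ξ (le_of_lt hξ)).2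
    have h1 := MeasureTheory.intervalIntegral_tendsto_integral_Ioi 0 hint tendsto_id
    have h2 := tendsto_boundary_term hτ hα hB hC hc hc' hW hR
    have h3 := (h2.sub_const (W (c * τ 0 / (2 * R)) * (τ' 0 - α))).sub h1
    rw [zero_sub] at h3
    refine h3.congr fun X => ?_
    exact (intervalIntegral.integral_mul_deriv_eq_deriv_mul
      (fun ξ _ => hasDerivAt_primitive_comp hτ hW c R ξ)
      (fun ξ _ => (hτ' ξ).sub_const (α : ℂ))
      ((hDc R).intervalIntegrable _ _) (hP.intervalIntegrable _ _)).symm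
  · obtain ⟨K, hK, h⟩ := exists_norm_wfun_mul_le' hα hB hC hc hc' one_pos
    have h1 : Tendsto (fun R : ℝ => W (c * τ 0 / (2 * R))) atTop (𝓝 0) := by
      rw [← hW0]
      refine (hW 0).continuousAt.tendsto.comp ?_
      rw [tendsto_zero_iff_norm_tendsto_zero]
      have h2 : Tendsto (fun R : ℝ => 2 * R) atTop atTop :=
        tendsto_id.const_mul_atTop (by norm_num)
      refine (h2.const_div_atTop ‖c * τ 0‖).congr' ((eventually_ge_atTop 0).mono fun R hR => ?_)
      simp only
      rw [norm_div, norm_mul 2, Complex.norm_real, Real.norm_of_nonneg hR, Complex.norm_ofNat]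
    have h2 : Tendsto (fun R : ℝ => ∫ ξ in Set.Ioi (0:ℝ),
        wfun (c * τ ξ / (2 * R)) * (c * τ' ξ / (2 * R)) * (τ' ξ - α)) atTop
        (𝓝 (∫ ξ in Set.Ioi (0:ℝ), 0)) := by
      refine MeasureTheory.tendsto_integral_filter_of_dominated_convergence _
        (Eventually.of_forall fun R =>
          ((hDc R).mul (hτc'.sub continuous_const)).aestronglyMeasurable) ?_ (hmaj K) ?_
      · filter_upwards [eventually_ge_atTop 1] with R hR
        exact (MeasureTheory.ae_restrict_mem measurableSet_Ioi).mono fun ξ hξ =>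
          hbound K hK ξ (le_of_lt hξ) _ (h R hR ξ (le_of_lt hξ)).2
      · refine (MeasureTheory.ae_restrict_mem measurableSet_Ioi).mono fun ξ hξ => ?_
        have h3 : Tendsto (fun R : ℝ => wfun (c * τ ξ / (2 * R)) * (c * τ' ξ / (2 * R)))
            atTop (𝓝 0) :=
          squeeze_zero_norm' ((eventually_ge_atTop 1).mono fun R hR =>
            (h R hR ξ (le_of_lt hξ)).1) (tendsto_id.const_div_atTop K)
        simpa using h3.mul_const (τ' ξ - α)
    simpa using (h1.mul_const (τ' 0 - (α : ℂ))).neg.sub h2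

end OscillatoryTail

/-- The second primitive of `ξ ↦ (2k/√π) e^{-(kξ)²}` with derivative `ξ ↦ erf (kξ)`. -/
noncomputable def cerfPrimitive (k : ℂ) (ξ : ℝ) : ℂ :=
  1 / (Real.sqrt Real.pi * k) * Complex.exp (-(k * ξ) ^ 2) + ξ * cerf (k * ξ)

theorem sqrt_pi_ne_zero : (Real.sqrt Real.pi : ℂ) ≠ 0 :=
  Complex.ofReal_ne_zero.2 (Real.sqrt_ne_zero'.2 Real.pi_pos)

theorem hasDerivAt_cerf_mul (k : ℂ) (ξ : ℝ) :
    HasDerivAt (fun ξ : ℝ => cerf (k * ξ))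
      (2 * k / Real.sqrt Real.pi * Complex.exp (-(k * ξ) ^ 2)) ξ := by
  have h1 : HasDerivAt (fun ξ : ℝ => k * (ξ : ℂ)) k ξ := by
    simpa using (Complex.ofRealCLM.hasDerivAt (x := ξ)).const_mul k
  refine ((hasDerivAt_cerf _).comp ξ h1).congr_deriv ?_
  ring

theorem hasDerivAt_cerfPrimitive {k : ℂ} (hk : k ≠ 0) (ξ : ℝ) :
    HasDerivAt (cerfPrimitive k) (cerf (k * ξ)) ξ := by
  have h1 : HasDerivAt (fun ξ : ℝ => k * (ξ : ℂ)) k ξ := by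
    simpa using (Complex.ofRealCLM.hasDerivAt (x := ξ)).const_mul k
  have h2 : HasDerivAt (fun ξ : ℝ => (ξ : ℂ)) 1 ξ := by
    simpa using (hasDerivAt_id ξ).ofReal_comp
  have h3 := ((h1.fun_pow 2).fun_neg.cexp.const_mul (1 / (Real.sqrt Real.pi * k))).add
    (h2.mul (hasDerivAt_cerf_mul k ξ))
  refine h3.congr_deriv ?_
  have := sqrt_pi_ne_zero
  field_simp
  ring

theorem norm_cerf_mul_sub_one_le {k : ℂ} (hk : 0 < k.re) (hk2 : (k ^ 2).re = 0) {ξ : ℝ}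
    (hξ : 0 ≤ ξ) : ‖cerf (k * ξ) - 1‖ ≤ 3 / (1 + k.re * ξ) := by
  have h0 : (k * ξ).re = k.re * ξ := Complex.re_mul_ofReal k ξ
  have h := norm_one_sub_cerf_le (y := k * ξ) (by rw [h0]; positivity) (by
    rw [mul_pow, ← Complex.ofReal_pow, Complex.re_mul_ofReal, hk2, zero_mul])
  rwa [h0, norm_sub_rev] at h

theorem norm_cerf_mul_sub_one_le' {k : ℂ} (hk : 0 < k.re) (hk2 : (k ^ 2).re = 0) {ξ : ℝ}
    (hξ : 0 ≤ ξ) : ‖cerf (k * ξ) - 1‖ ≤ 3 * (1 + 1 / k.re) / (1 + ξ) := by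
  refine (norm_cerf_mul_sub_one_le hk hk2 hξ).trans ?_
  have h1 : 0 ≤ k.re * ξ := by positivity
  have h2 : 0 < 1 / k.re := by positivity
  have h3 : 1 / k.re * (k.re * ξ) = ξ := by field_simp
  rw [div_le_div_iff₀ (by linarith) (by linarith)]
  nlinarith

theorem norm_cerfPrimitive_sub_le {k : ℂ} (hk : 0 < k.re) (hk2 : (k ^ 2).re = 0) {ξ : ℝ}
    (hξ : 0 ≤ ξ) :
    ‖cerfPrimitive k ξ - ξ‖ ≤ ‖1 / (Real.sqrt Real.pi * k)‖ + 3 / k.re := by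
  have e : cerfPrimitive k ξ - ξ = 1 / (Real.sqrt Real.pi * k) * Complex.exp (-(k * ξ) ^ 2) +
      ξ * (cerf (k * ξ) - 1) := by
    rw [cerfPrimitive]
    ring
  have e2 : (-(k * ξ) ^ 2).re = 0 := by
    rw [Complex.neg_re, mul_pow, ← Complex.ofReal_pow, Complex.re_mul_ofReal, hk2, zero_mul,
      neg_zero]
  rw [e]
  refine (norm_add_le _ _).trans ?_
  rw [norm_mul, norm_mul, Complex.norm_exp, e2, Real.exp_zero, mul_one, Complex.norm_real,
    Real.norm_of_nonneg hξ]
  gcongr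
  have h1 : 0 ≤ k.re * ξ := by positivity
  calc ξ * ‖cerf (k * ξ) - 1‖ ≤ ξ * (3 / (1 + k.re * ξ)) := by
        gcongr
        exact norm_cerf_mul_sub_one_le hk hk2 hξ
    _ ≤ 3 / k.re := by
        rw [mul_div_assoc', div_le_div_iff₀ (by linarith) hk]
        linarith

theorem exp_I_mul_pi_div_four_sq : Complex.exp (Complex.I * (Real.pi / 4)) ^ 2 = Complex.I := by
  have h : ((2 : ℕ) : ℂ) * (Complex.I * (Real.pi / 4)) = Real.pi / 2 * Complex.I := by
    push_cast
    ring
  rw [← Complex.exp_nat_mul, h, Complex.exp_pi_div_two_mul_I]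

theorem exp_neg_I_mul_pi_div_four_sq :
    Complex.exp (-(Complex.I * (Real.pi / 4))) ^ 2 = -Complex.I := by
  rw [Complex.exp_neg, inv_pow, exp_I_mul_pi_div_four_sq, Complex.inv_I]

theorem exp_I_mul_pi_div_four_re :
    (Complex.exp (Complex.I * (Real.pi / 4))).re = Real.sqrt 2 / 2 := by
  have h : Complex.I * (Real.pi / 4) = ((Real.pi / 4 : ℝ) : ℂ) * Complex.I := by push_cast; ring
  rw [h, Complex.exp_ofReal_mul_I_re, Real.cos_pi_div_four]

theorem exp_neg_I_mul_pi_div_four_re :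
    (Complex.exp (-(Complex.I * (Real.pi / 4)))).re = Real.sqrt 2 / 2 := by
  have h : -(Complex.I * (Real.pi / 4)) = ((-(Real.pi / 4) : ℝ) : ℂ) * Complex.I := by
    push_cast; ring
  rw [h, Complex.exp_ofReal_mul_I_re, Real.cos_neg, Real.cos_pi_div_four]

theorem exp_three_pi_div_four_im :
    (Complex.exp (Complex.I * (3 * Real.pi / 4))).im = Real.sqrt 2 / 2 := by
  have h : Complex.I * (3 * Real.pi / 4) = ((Real.pi - Real.pi / 4 : ℝ) : ℂ) * Complex.I := by
    push_cast; ring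
  rw [h, Complex.exp_ofReal_mul_I_im, Real.sin_pi_sub, Real.sin_pi_div_four]

theorem norm_exp_three_pi_div_four : ‖Complex.exp (Complex.I * (3 * Real.pi / 4))‖ = 1 := by
  have h : Complex.I * (3 * Real.pi / 4) = ((3 * Real.pi / 4 : ℝ) : ℂ) * Complex.I := by
    push_cast; ring
  rw [h, Complex.norm_exp_ofReal_mul_I]

theorem neg_sq_exp_neg_div {η : ℝ} (hη : 0 < η) (ξ : ℝ) :
    -(Complex.exp (-(Complex.I * (Real.pi / 4))) / (2 * Real.sqrt η) * ξ) ^ 2 =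
      Complex.I * (ξ ^ 2 / (4 * η)) := by
  have h : (Real.sqrt η : ℂ) ^ 2 = η := by
    rw [← Complex.ofReal_pow, Real.sq_sqrt hη.le]
  rw [mul_pow, div_pow, mul_pow, h, exp_neg_I_mul_pi_div_four_sq]
  ring

theorem neg_sq_exp_div (ξ : ℝ) :
    -(Complex.exp (Complex.I * (Real.pi / 4)) / 2 * ξ) ^ 2 = -(Complex.I * (ξ ^ 2 / 4)) := by
  rw [mul_pow, div_pow, exp_I_mul_pi_div_four_sq]
  ring

theorem taufun_eq (a : ℕ) {η : ℝ} (hη : 0 < η) (ξ : ℝ) :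
    taufun a η ξ =
      cerfPrimitive (Complex.exp (-(Complex.I * (Real.pi / 4))) / (2 * Real.sqrt η)) ξ +
      ((a : ℂ) - 1) * cerfPrimitive (Complex.exp (Complex.I * (Real.pi / 4)) / 2) ξ := by
  have hs : (Real.sqrt η : ℂ) ≠ 0 := Complex.ofReal_ne_zero.2 (Real.sqrt_ne_zero'.2 hη)
  have hp := sqrt_pi_ne_zero
  have he := Complex.exp_ne_zero (Complex.I * (Real.pi / 4))
  rw [taufun, cerfPrimitive, cerfPrimitive, neg_sq_exp_neg_div hη, neg_sq_exp_div,
    mul_add Complex.I _ ((ξ : ℂ) ^ 2 / (4 * η)), mul_add Complex.I _ ((ξ : ℂ) ^ 2 / 4),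
    Complex.exp_add, neg_add, Complex.exp_add,
    mul_div_right_comm (Complex.exp (-(Complex.I * (Real.pi / 4)))) (ξ : ℂ),
    mul_div_right_comm (Complex.exp (Complex.I * (Real.pi / 4))) (ξ : ℂ), Complex.exp_neg
      (Complex.I * (Real.pi / 4))]
  field_simp
  ring

theorem Pfun_eq (a : ℕ) {η : ℝ} (hη : 0 < η) (ξ : ℝ) :
    Pfun a η ξ =
      2 * (Complex.exp (-(Complex.I * (Real.pi / 4))) / (2 * Real.sqrt η)) / Real.sqrt Real.pi *
        Complex.exp (-(Complex.exp (-(Complex.I * (Real.pi / 4))) / (2 * Real.sqrt η) * ξ) ^ 2) +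
      ((a : ℂ) - 1) * (2 * (Complex.exp (Complex.I * (Real.pi / 4)) / 2) / Real.sqrt Real.pi *
        Complex.exp (-(Complex.exp (Complex.I * (Real.pi / 4)) / 2 * ξ) ^ 2)) := by
  have hs : (Real.sqrt η : ℂ) ≠ 0 := Complex.ofReal_ne_zero.2 (Real.sqrt_ne_zero'.2 hη)
  have hp := sqrt_pi_ne_zero
  rw [Pfun, neg_sq_exp_neg_div hη, neg_sq_exp_div, mul_sub, mul_sub, sub_eq_add_neg,
    Complex.exp_add, sub_eq_add_neg (Complex.I * (Real.pi / 4)), Complex.exp_add,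
    Real.sqrt_mul Real.pi_pos.le, Complex.ofReal_mul]
  field_simp

/-- The tail integrals vanish:
`∫_0^∞ [∫_{−∞}^{−R²} P_η(ξ) (e^{3iπ/4} τ_η(ξ)/(2(−σ)^{3/2})) w(e^{3iπ/4} τ_η(ξ)/(2√(−σ))) dσ] dξ → 0`
as `R → ∞`; the inner integral converges absolutely and the outer improper integral
(as a limit of `∫_0^X`) exists for every `R > 0`. -/
theorem tail_integral_vanishes (a : ℕ) (ha : 1 ≤ a) (η : ℝ) (hη : 0 < η) :
    (∀ R : ℝ, 0 < R → ∀ ξ : ℝ, 0 ≤ ξ →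
      MeasureTheory.IntegrableOn
        (fun σ : ℝ => Pfun a η ξ *
          (Complex.exp (Complex.I * (3 * Real.pi / 4)) * taufun a η ξ /
            ((2 * Real.sqrt (-σ) ^ 3 : ℝ) : ℂ)) *
          wfun (Complex.exp (Complex.I * (3 * Real.pi / 4)) * taufun a η ξ /
            (2 * Real.sqrt (-σ))))
        (Set.Iic (-(R ^ 2)))) ∧
    ∃ J : ℝ → ℂ,
      (∀ R : ℝ, 0 < R → Tendsto
        (fun X : ℝ => ∫ ξ in (0:ℝ)..X,
          ∫ σ in Set.Iic (-(R ^ 2)), Pfun a η ξ *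
            (Complex.exp (Complex.I * (3 * Real.pi / 4)) * taufun a η ξ /
              ((2 * Real.sqrt (-σ) ^ 3 : ℝ) : ℂ)) *
            wfun (Complex.exp (Complex.I * (3 * Real.pi / 4)) * taufun a η ξ /
              (2 * Real.sqrt (-σ))))
        atTop (𝓝 (J R))) ∧
      Tendsto J atTop (𝓝 0) := by
  set c : ℂ := Complex.exp (Complex.I * (3 * Real.pi / 4)) with hc
  set k₁ : ℂ := Complex.exp (-(Complex.I * (Real.pi / 4))) / (2 * Real.sqrt η) with hk₁
  set k₂ : ℂ := Complex.exp (Complex.I * (Real.pi / 4)) / 2 with hk₂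
  have hsη : 0 < Real.sqrt η := Real.sqrt_pos.2 hη
  have hk₁re : 0 < k₁.re := by
    have h : k₁ = Complex.exp (-(Complex.I * (Real.pi / 4))) / ((2 * Real.sqrt η : ℝ) : ℂ) := by
      rw [hk₁]; push_cast; rfl
    rw [h, Complex.div_ofReal_re, exp_neg_I_mul_pi_div_four_re]
    positivity
  have hk₂re : 0 < k₂.re := by
    have h : k₂ = Complex.exp (Complex.I * (Real.pi / 4)) / ((2 : ℝ) : ℂ) := by
      rw [hk₂]; push_cast; rfl
    rw [h, Complex.div_ofReal_re, exp_I_mul_pi_div_four_re]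
    positivity
  have hk₁sq : (k₁ ^ 2).re = 0 := by
    have h := neg_sq_exp_neg_div hη 1
    rw [← hk₁, Complex.ofReal_one, mul_one] at h
    have h' : k₁ ^ 2 = Complex.I * ((-(1 / (4 * η)) : ℝ) : ℂ) := by
      push_cast
      linear_combination -h
    rw [h', Complex.re_mul_ofReal, Complex.I_re, zero_mul]
  have hk₂sq : (k₂ ^ 2).re = 0 := by
    have h := neg_sq_exp_div 1
    rw [← hk₂, Complex.ofReal_one, mul_one] at h
    have h' : k₂ ^ 2 = Complex.I * ((1 / 4 : ℝ) : ℂ) := by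
      push_cast
      linear_combination -h
    rw [h', Complex.re_mul_ofReal, Complex.I_re, zero_mul]
  have hk₁0 : k₁ ≠ 0 := fun h => by simp [h] at hk₁re
  have hk₂0 : k₂ ≠ 0 := fun h => by simp [h] at hk₂re
  have haR : (1 : ℝ) ≤ a := by exact_mod_cast ha
  have hna : ‖(a : ℂ) - 1‖ = a - 1 := by
    have h : (a : ℂ) - 1 = ((a - 1 : ℝ) : ℂ) := by push_cast; rfl
    rw [h, Complex.norm_real, Real.norm_of_nonneg (by linarith)]
  obtain ⟨E, hE⟩ := exists_entire_primitive differentiable_wfun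
  set W : ℂ → ℂ := fun z => E z - E 0 with hWdef
  have hW : ∀ z, HasDerivAt W (wfun z) z := fun z => (hE z).sub_const _
  have hW0 : W 0 = 0 := sub_self _
  have hτ : ∀ ξ : ℝ, HasDerivAt (taufun a η)
      (cerf (k₁ * ξ) + ((a : ℂ) - 1) * cerf (k₂ * ξ)) ξ := by
    intro ξ
    rw [funext (taufun_eq a hη)]
    exact (hasDerivAt_cerfPrimitive hk₁0 ξ).add ((hasDerivAt_cerfPrimitive hk₂0 ξ).const_mul _)
  have hτ' : ∀ ξ : ℝ, HasDerivAt (fun ξ : ℝ => cerf (k₁ * ξ) + ((a : ℂ) - 1) * cerf (k₂ * ξ))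
      (Pfun a η ξ) ξ := by
    intro ξ
    rw [Pfun_eq a hη]
    exact (hasDerivAt_cerf_mul k₁ ξ).add ((hasDerivAt_cerf_mul k₂ ξ).const_mul _)
  have hP : Continuous (Pfun a η) := by
    unfold Pfun
    fun_prop
  have hB : ∀ ξ : ℝ, 0 ≤ ξ → ‖taufun a η ξ - (a : ℝ) * ξ‖ ≤
      (‖1 / (Real.sqrt Real.pi * k₁)‖ + 3 / k₁.re) +
        (a - 1) * (‖1 / (Real.sqrt Real.pi * k₂)‖ + 3 / k₂.re) := by
    intro ξ hξ
    have e : taufun a η ξ - (a : ℝ) * ξ =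
        (cerfPrimitive k₁ ξ - ξ) + ((a : ℂ) - 1) * (cerfPrimitive k₂ ξ - ξ) := by
      rw [taufun_eq a hη]
      push_cast
      ring
    rw [e]
    refine (norm_add_le _ _).trans ?_
    rw [norm_mul, hna]
    exact add_le_add (norm_cerfPrimitive_sub_le hk₁re hk₁sq hξ) (mul_le_mul_of_nonneg_left
      (norm_cerfPrimitive_sub_le hk₂re hk₂sq hξ) (by linarith))
  have hC : ∀ ξ : ℝ, 0 ≤ ξ →
      ‖cerf (k₁ * ξ) + ((a : ℂ) - 1) * cerf (k₂ * ξ) - ((a : ℝ) : ℂ)‖ ≤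
      (3 * (1 + 1 / k₁.re) + (a - 1) * (3 * (1 + 1 / k₂.re))) / (1 + ξ) := by
    intro ξ hξ
    have e : cerf (k₁ * ξ) + ((a : ℂ) - 1) * cerf (k₂ * ξ) - ((a : ℝ) : ℂ) =
        (cerf (k₁ * ξ) - 1) + ((a : ℂ) - 1) * (cerf (k₂ * ξ) - 1) := by
      push_cast
      ring
    rw [e, add_div, mul_div_assoc (a - 1 : ℝ)]
    refine (norm_add_le _ _).trans ?_
    rw [norm_mul, hna]
    exact add_le_add (norm_cerf_mul_sub_one_le' hk₁re hk₁sq hξ) (mul_le_mul_of_nonneg_left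
      (norm_cerf_mul_sub_one_le' hk₂re hk₂sq hξ) (by linarith))
  have hcim : 7 / 10 ≤ c.im := by
    rw [hc, exp_three_pi_div_four_im]
    have : (7 / 5 : ℝ) ≤ Real.sqrt 2 := Real.le_sqrt_of_sq_le (by norm_num)
    linarith
  constructor
  · intro R hR ξ _
    simp_rw [mul_assoc]
    exact (integral_tail_wfun hW (c * taufun a η ξ) hR).1.const_mul _
  · obtain ⟨J, hJ, hJ0⟩ := exists_tendsto_integral_primitive hτ hτ' hP haR hB hC
      norm_exp_three_pi_div_four hcim hW hW0
    refine ⟨fun R => 2 * J R, fun R hR => ?_, by simpa using hJ0.const_mul 2⟩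
    refine ((hJ R hR).const_mul 2).congr fun X => ?_
    rw [← intervalIntegral.integral_const_mul]
    congr 1
    funext ξ
    simp_rw [mul_assoc (Pfun a η ξ)]
    rw [MeasureTheory.integral_const_mul, (integral_tail_wfun hW (c * taufun a η ξ) hR).2, hW0,
      sub_zero]
    ring
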